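/- Every generalized projective space is an exchange space: for every subset 𝒮 ⊆ 𝒫 and all points A, B ∈ 𝒫, if B ∈ (𝒮 ∨ {A}) \ ⟨𝒮⟩ then A ∈ 𝒮 ∨ {B}. -/

import Mathlib

/-- A linear space: a point set `P` together with a set of lines (subsets of `P`),
each line having at least two points, and any two distinct points lying on
exactly one line. -/
structure LinearSpace (P : Type*) where
  lines : Set (Set P)
  two_points : ∀ l ∈ lines, ∃ A B : P, A ≠ B ∧ A ∈ l ∧ B ∈ l
  unique_line : ∀ A B : P, A ≠ B → ∃! l, l ∈ lines ∧ A ∈ l ∧ B ∈ l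

namespace LinearSpace

variable {P : Type*} (LS : LinearSpace P)

/-- A subspace: a subset containing, with any two of its distinct points,
the line joining them. -/
def IsSubspace (S : Set P) : Prop :=
  ∀ l ∈ LS.lines, ∀ A ∈ l, ∀ B ∈ l, A ≠ B → A ∈ S → B ∈ S → l ⊆ S

/-- The span of a subset: the intersection of all subspaces containing it. -/
def span (S : Set P) : Set P :=
  ⋂₀ {T | LS.IsSubspace T ∧ S ⊆ T}

/-- The dimension of a subset `S` (intended for subspaces):
`min {#X - 1 | X ⊆ S, span X = S}` as an extended natural number. -/
noncomputable def sdim (S : Set P) : ℕ∞ :=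
  sInf {d : ℕ∞ | ∃ X : Set P, X ⊆ S ∧ LS.span X = S ∧ d = X.encard - 1}

/-- The dimension of the linear space: `min {#X - 1 | span X = P}`. -/
noncomputable def dim : ℕ∞ := LS.sdim Set.univ

/-- A plane is a 2-dimensional subspace. -/
def IsPlane (E : Set P) : Prop := LS.IsSubspace E ∧ LS.sdim E = 2

/-- A generalized projective space: every plane is a generalized projective
plane, i.e. any two distinct lines contained in a common plane meet. -/
def IsGenProjSpace : Prop :=
  ∀ E : Set P, LS.IsPlane E →
    ∀ l ∈ LS.lines, ∀ m ∈ LS.lines, l ⊆ E → m ⊆ E → l ≠ m → (l ∩ m).Nonempty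

/-- A related set: a set of lines which pairwise meet. -/
def IsRelatedSet (N : Set (Set P)) : Prop :=
  N ⊆ LS.lines ∧ ∀ a ∈ N, ∀ b ∈ N, (a ∩ b).Nonempty

/-- A maximal related set: a related set maximal with respect to inclusion. -/
def IsMaxRelatedSet (M : Set (Set P)) : Prop :=
  LS.IsRelatedSet M ∧ ∀ N, LS.IsRelatedSet N → M ⊆ N → N = M

/-- The star of lines with vertex `A`: all lines through `A`. -/
def star (A : P) : Set (Set P) := {l | l ∈ LS.lines ∧ A ∈ l}

/-- The pencil of planes with axis `a`: all planes containing `a`. -/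
def pencil (a : Set P) : Set (Set P) := {E | LS.IsPlane E ∧ a ⊆ E}

/-- A collineation: a bijection of the point sets mapping each line onto a
line, and whose inverse does likewise. -/
def IsCollineation {P' : Type*} (LS' : LinearSpace P') (κ : P → P') : Prop :=
  Function.Bijective κ ∧ (∀ l ∈ LS.lines, κ '' l ∈ LS'.lines) ∧
    (∀ l' ∈ LS'.lines, κ ⁻¹' l' ∈ LS.lines)

end LinearSpace

namespace LinearSpace

variable {P : Type*} {LS : LinearSpace P}

theorem subset_span (S : Set P) : S ⊆ LS.span S :=
  Set.subset_sInter fun _ hT => hT.2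

theorem span_subset {S T : Set P} (hT : LS.IsSubspace T) (h : S ⊆ T) : LS.span S ⊆ T :=
  Set.sInter_subset_of_mem ⟨hT, h⟩

theorem span_mono {S T : Set P} (h : S ⊆ T) : LS.span S ⊆ LS.span T :=
  Set.sInter_subset_sInter fun _ hU => ⟨hU.1, h.trans hU.2⟩

theorem isSubspace_span (S : Set P) : LS.IsSubspace (LS.span S) :=
  fun l hl X hX Y hY hXY hXS hYS => Set.subset_sInter fun T hT =>
    hT.1 l hl X hX Y hY hXY (hXS T hT) (hYS T hT)

theorem line_eq {l m : Set P} (hl : l ∈ LS.lines) (hm : m ∈ LS.lines) {X Y : P} (hXY : X ≠ Y)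
    (hXl : X ∈ l) (hYl : Y ∈ l) (hXm : X ∈ m) (hYm : Y ∈ m) : l = m :=
  (LS.unique_line X Y hXY).unique ⟨hl, hXl, hYl⟩ ⟨hm, hXm, hYm⟩

theorem isSubspace_line {l : Set P} (hl : l ∈ LS.lines) : LS.IsSubspace l := by
  intro m hm X hXm Y hYm hXY hXl hYl
  exact (line_eq hm hl hXY hXm hYm hXl hYl).subset

theorem isSubspace_of_subsingleton {S : Set P} (hS : S.Subsingleton) : LS.IsSubspace S :=
  fun _ _ _ _ _ _ hXY hX hY => absurd (hS hX hY) hXY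

/-- Three non-collinear points span a plane. -/
theorem isPlane_span_triangle {m : Set P} (hm : m ∈ LS.lines) {A Y Z : P} (hA : A ∉ m)
    (hY : Y ∈ m) (hZ : Z ∈ m) (hYZ : Y ≠ Z) : LS.IsPlane (LS.span {A, Y, Z}) := by
  have hAY : A ≠ Y := fun h => hA (h ▸ hY)
  have hAZ : A ≠ Z := fun h => hA (h ▸ hZ)
  have hAE : A ∈ LS.span {A, Y, Z} := subset_span _ (by simp)
  have hYE : Y ∈ LS.span {A, Y, Z} := subset_span _ (by simp)
  have hZE : Z ∈ LS.span {A, Y, Z} := subset_span _ (by simp)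
  refine ⟨isSubspace_span _, le_antisymm (sInf_le ⟨{A, Y, Z}, subset_span _, rfl, ?_⟩)
    (le_sInf ?_)⟩
  · rw [Set.encard_eq_three.2 ⟨A, Y, Z, hAY, hAZ, hYZ, rfl⟩]
    rfl
  · rintro _ ⟨X, -, hX, rfl⟩
    have hX1 : ¬ X.encard ≤ 1 := fun h => by
      have hs : X.Subsingleton := Set.encard_le_one_iff_subsingleton.1 h
      have hsub : LS.span X ⊆ X := span_subset (isSubspace_of_subsingleton hs) subset_rfl
      rw [hX] at hsub
      exact hAY (hs (hsub hAE) (hsub hYE))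
    have hX2 : X.encard ≠ 2 := fun h => by
      obtain ⟨a, b, hab, rfl⟩ := Set.encard_eq_two.1 h
      obtain ⟨l, ⟨hl, hal, hbl⟩, -⟩ := LS.unique_line a b hab
      have hsub : LS.span {a, b} ⊆ l :=
        span_subset (isSubspace_line hl) (Set.pair_subset hal hbl)
      rw [hX] at hsub
      exact hA (line_eq hl hm hYZ (hsub hYE) (hsub hZE) hY hZ ▸ hsub hAE)
    generalize X.encard = n at hX1 hX2
    induction n using ENat.recTopCoe with
    | top => simp
    | coe n =>
      norm_cast at hX1 hX2 ⊢
      omega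

/-- The cone with apex `A` over `T`: the point `A` and all points on lines joining `A` to a point
of `T`. -/
def cone (LS : LinearSpace P) (A : P) (T : Set P) : Set P :=
  insert A {W | ∃ X ∈ T, ∃ l ∈ LS.lines, A ∈ l ∧ X ∈ l ∧ W ∈ l}

theorem line_subset_cone {A X : P} {T l : Set P} (hl : l ∈ LS.lines) (hX : X ∈ T)
    (hAl : A ∈ l) (hXl : X ∈ l) : l ⊆ LS.cone A T :=
  fun _ hW => Or.inr ⟨X, hX, l, hl, hAl, hXl, hW⟩

theorem subset_cone {A : P} {T : Set P} (hA : A ∉ T) : T ⊆ LS.cone A T := by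
  intro X hX
  obtain ⟨l, ⟨hl, hAl, hXl⟩, -⟩ := LS.unique_line A X fun h => hA (h ▸ hX)
  exact line_subset_cone hl hX hAl hXl hXl

theorem IsGenProjSpace.isSubspace_cone (hGPS : LS.IsGenProjSpace) {A : P} {T : Set P}
    (hT : LS.IsSubspace T) (hA : A ∉ T) : LS.IsSubspace (LS.cone A T) := by
  intro l hl Y hYl Z hZl hYZ hY hZ
  rcases hY with rfl | ⟨Y', hY', p, hp, hAp, hY'p, hYp⟩
  · rcases hZ with rfl | ⟨Z', hZ', q, hq, hAq, hZ'q, hZq⟩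
    · exact absurd rfl hYZ
    · rw [line_eq hl hq hYZ hYl hZl hAq hZq]
      exact line_subset_cone hq hZ' hAq hZ'q
  rcases hZ with rfl | ⟨Z', hZ', q, hq, hAq, hZ'q, hZq⟩
  · rw [line_eq hl hp hYZ hYl hZl hYp hAp]
    exact line_subset_cone hp hY' hAp hY'p
  have hAY' : A ≠ Y' := fun h => hA (h ▸ hY')
  have hAZ' : A ≠ Z' := fun h => hA (h ▸ hZ')
  by_cases hYZ' : Y' = Z'
  · subst hYZ'
    obtain rfl := line_eq hp hq hAY' hAp hY'p hAq hZ'q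
    rw [line_eq hl hp hYZ hYl hZl hYp hZq]
    exact line_subset_cone hp hY' hAp hY'p
  obtain ⟨m, ⟨hm, hY'm, hZ'm⟩, -⟩ := LS.unique_line Y' Z' hYZ'
  have hmT : m ⊆ T := hT m hm Y' hY'm Z' hZ'm hYZ' hY' hZ'
  have hAm : A ∉ m := fun h => hA (hmT h)
  have hE : LS.IsSubspace (LS.span {A, Y', Z'}) := isSubspace_span _
  have hAE : A ∈ LS.span {A, Y', Z'} := subset_span _ (by simp)
  have hYE : Y' ∈ LS.span {A, Y', Z'} := subset_span _ (by simp)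
  have hZE : Z' ∈ LS.span {A, Y', Z'} := subset_span _ (by simp)
  have hlE : l ⊆ LS.span {A, Y', Z'} := hE l hl Y hYl Z hZl hYZ
    (hE p hp A hAp Y' hY'p hAY' hAE hYE hYp) (hE q hq A hAq Z' hZ'q hAZ' hAE hZE hZq)
  intro W hW
  by_cases hAW : A = W
  · exact Or.inl hAW.symm
  obtain ⟨k, ⟨hk, hAk, hWk⟩, -⟩ := LS.unique_line A W hAW
  obtain ⟨X, hXk, hXm⟩ := hGPS _ (isPlane_span_triangle hm hAm hY'm hZ'm hYZ') k hk m hm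
    (hE k hk A hAk W hWk hAW hAE (hlE hW)) (hE m hm Y' hY'm Z' hZ'm hYZ' hYE hZE)
    fun h => hAm (h ▸ hAk)
  exact line_subset_cone hk (hmT hXm) hAk hXk hWk

end LinearSpace

/-- Every generalized projective space is an exchange space. -/
theorem genProjSpace_exchange
    {P : Type*} (LS : LinearSpace P) (hGPS : LS.IsGenProjSpace)
    (S : Set P) (A B : P)
    (hB : B ∈ LS.span (S ∪ {A}) \ LS.span S) :
    A ∈ LS.span (S ∪ {B}) := by
  obtain ⟨hBA, hBS⟩ := hB
  have hAS : A ∉ LS.span S := fun h => hBS <| LinearSpace.span_subset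
    (LinearSpace.isSubspace_span S)
    (Set.union_subset (LinearSpace.subset_span S) (Set.singleton_subset_iff.2 h)) hBA
  have hBc : B ∈ LS.cone A (LS.span S) := LinearSpace.span_subset
    (hGPS.isSubspace_cone (LinearSpace.isSubspace_span S) hAS)
    (Set.union_subset ((LinearSpace.subset_span S).trans (LinearSpace.subset_cone hAS))
      (Set.singleton_subset_iff.2 (Set.mem_insert A _))) hBA
  have hB' : B ∈ LS.span (S ∪ {B}) := LinearSpace.subset_span _ (by simp)
  rcases hBc with rfl | ⟨X, hX, l, hl, hAl, hXl, hBl⟩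
  · exact hB'
  · exact LinearSpace.isSubspace_span _ l hl B hBl X hXl (fun h => hBS (h ▸ hX)) hB'
      (LinearSpace.span_mono Set.subset_union_left hX) hAl
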